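/- Let W_b(y_a,u_a,d_b|u_b) be a joint channel in successive form and D-value representation, and define W_b*(d_b|u_b) = Σ_{y_a,u_a} W_b(y_a,u_a,d_b|u_b). Suppose Q_b*(z_b|u_b) is a binary-input channel upgraded from W_b* with degrading channel P_b*(d_b|z_b). Then there exists a successive-form joint channel Q_b(y_a,u_a,z_b|u_b) such that Q_b ≽p W_b and Σ_{y_a,u_a} Q_b(y_a,u_a,z_b|u_b) = Q_b*(z_b|u_b) for all z_b,u_b; moreover, the a-channel marginal of Q_b coincides with the a-channel marginal W_a of W_b. -/

import Mathlib

open Finset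

/-- `W y u` is the probability that the channel outputs `y` given input `u`. -/
def IsChannel {Y U : Type*} [Fintype Y] (W : Y → U → ℝ) : Prop :=
  (∀ y u, 0 ≤ W y u) ∧ ∀ u, ∑ y, W y u = 1

/-- A randomized decoder: `φ y u` is the probability of declaring `u` upon observing `y`. -/
def IsDecoder {Y : Type*} (φ : Y → Bool → ℝ) : Prop :=
  (∀ y u, 0 ≤ φ y u) ∧ ∀ y, ∑ u, φ y u = 1

/-- A joint channel with two binary inputs and outputs in `Ya × Yb`. -/
def IsJointChannel {Ya Yb : Type*} [Fintype Ya] [Fintype Yb]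
    (W : Ya → Yb → Bool → Bool → ℝ) : Prop :=
  (∀ ya yb ua ub, 0 ≤ W ya yb ua ub) ∧ ∀ ua ub, ∑ ya, ∑ yb, W ya yb ua ub = 1

/-- a-channel marginal of a joint channel (inputs equiprobable). -/
noncomputable def margA {Ya Yb : Type*} [Fintype Ya] [Fintype Yb]
    (W : Ya → Yb → Bool → Bool → ℝ) (ya : Ya) (ua : Bool) : ℝ :=
  (1 / 2) * ∑ ub, ∑ yb, W ya yb ua ub

/-- b-channel marginal of a joint channel (inputs equiprobable). -/
noncomputable def margB {Ya Yb : Type*} [Fintype Ya] [Fintype Yb]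
    (W : Ya → Yb → Bool → Bool → ℝ) (yb : Yb) (ub : Bool) : ℝ :=
  (1 / 2) * ∑ ua, ∑ ya, W ya yb ua ub

/-- `P(E_a ∪ E_b)`: the probability that at least one of the two decoders errs. -/
noncomputable def PerrUnion {Ya Yb : Type*} [Fintype Ya] [Fintype Yb]
    (W : Ya → Yb → Bool → Bool → ℝ)
    (φa : Ya → Bool → ℝ) (φb : Yb → Bool → ℝ) : ℝ :=
  1 - (1 / 4) * ∑ ua, ∑ ub, ∑ ya, ∑ yb, W ya yb ua ub * φa ya ua * φb yb ub

/-- Successive form: the b-output is `(y_a, u_a, y_r)` with probability one. -/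
def SuccessiveForm {Ya Yr : Type*} [Fintype Ya] [Fintype Yr] [DecidableEq Ya]
    (W : Ya → Ya × Bool × Yr → Bool → Bool → ℝ) : Prop :=
  ∀ ya ya' ua' yr ua ub,
    W ya (ya', ua', yr) ua ub =
      if ya' = ya ∧ ua' = ua then 2 * margB W (ya, ua, yr) ub else 0

/-- A maximum-likelihood decoder for the binary-input channel `V`. -/
def IsMLDecoder {Y : Type*} (V : Y → Bool → ℝ) (φ : Y → Bool → ℝ) : Prop :=
  ∀ y u, 0 < φ y u → V y u = max (V y false) (V y true)

/-- `W` is stochastically degraded from `Q`. -/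
def Degraded {Y Z U : Type*} [Fintype Y] [Fintype Z]
    (W : Y → U → ℝ) (Q : Z → U → ℝ) : Prop :=
  ∃ P : Z → Y → ℝ,
    (∀ z y, 0 ≤ P z y) ∧ (∀ z, ∑ y, P z y = 1) ∧
    ∀ y u, W y u = ∑ z, P z y * Q z u

/-- `Q` is properly upgraded from `W` (both joint channels in successive form). -/
def ProperUpgrade {Ya Yr Za Zr : Type*}
    [Fintype Ya] [Fintype Yr] [Fintype Za] [Fintype Zr]
    (Q : Za → Za × Bool × Zr → Bool → Bool → ℝ)
    (W : Ya → Ya × Bool × Yr → Bool → Bool → ℝ) : Prop :=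
  ∃ (Pa : Za → Ya → ℝ) (Pb : Za → Bool → Zr → Ya → Yr → ℝ),
    (∀ za ya, 0 ≤ Pa za ya) ∧ (∀ za, ∑ ya, Pa za ya = 1) ∧
    (∀ za ua zr ya yr, 0 ≤ Pb za ua zr ya yr) ∧
    (∀ za ua zr ya, ∑ yr, Pb za ua zr ya yr = 1) ∧
    ∀ ya ua yr ub,
      margB W (ya, ua, yr) ub =
        ∑ za, ∑ zr, Pa za ya * Pb za ua zr ya yr * margB Q (za, ua, zr) ub

/-- The minimum over decoder pairs of `P(E_a ∪ E_b)`. -/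
noncomputable def PeIMJP {Ya Yb : Type*} [Fintype Ya] [Fintype Yb]
    (W : Ya → Yb → Bool → Bool → ℝ) : ℝ :=
  sInf {p : ℝ | ∃ φa φb, IsDecoder φa ∧ IsDecoder φb ∧ p = PerrUnion W φa φb}

/-- Error probability of an ML decoder for a binary-input channel with equiprobable inputs. -/
noncomputable def PeML {Y : Type*} [Fintype Y] (V : Y → Bool → ℝ) : ℝ :=
  1 - (1 / 2) * ∑ y, max (V y false) (V y true)

/-- The `D`-value of an output of a binary-input channel. -/
noncomputable def dval {Y : Type*} (V : Y → Bool → ℝ) (y : Y) : ℝ :=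
  (V y false - V y true) / (V y false + V y true)

/-- D-value representation: the third component of each positive-probability b-output
is its b-channel D-value (`v` gives the real value of a rest symbol). -/
def DvalRepJoint {Ya R : Type*} [Fintype Ya] [Fintype R]
    (W : Ya → Ya × Bool × R → Bool → Bool → ℝ) (v : R → ℝ) : Prop :=
  ∀ ya ua r,
    0 < margB W (ya, ua, r) false + margB W (ya, ua, r) true →
    v r = dval (margB W) (ya, ua, r)

/-- A symmetrized joint channel (successive form, D-value representation). -/
def SymmetrizedJoint {Ya R : Type*} [Fintype Ya] [Fintype R]
    (W : Ya → Ya × Bool × R → Bool → Bool → ℝ)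
    (v : R → ℝ) (bar : Ya → Ya) (neg : R → R) : Prop :=
  Function.Involutive bar ∧ Function.Involutive neg ∧
  (∀ r, v (neg r) = -v r) ∧
  (∀ ya ua, margA W ya ua = margA W (bar ya) (!ua)) ∧
  (∀ ya ua r ub,
    margB W (ya, ua, r) ub = margB W (bar ya, !ua, r) ub ∧
    margB W (ya, ua, r) ub = margB W (ya, ua, neg r) (!ub) ∧
    margB W (ya, ua, r) ub = margB W (bar ya, !ua, neg r) (!ub))

/-- A decoupling decomposition `W_b = (1/2)·W_a·W_2` of a symmetrized joint channel. -/
def DecouplingDecomp {Ya R : Type*} [Fintype Ya] [Fintype R]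
    (W : Ya → Ya × Bool × R → Bool → Bool → ℝ)
    (W2 : R → Bool → Ya → Bool → ℝ) : Prop :=
  (∀ r ub ya ua, 0 ≤ W2 r ub ya ua) ∧
  (∀ ya ua ub, ∑ r, W2 r ub ya ua = 1) ∧
  ∀ ya ua r ub, margB W (ya, ua, r) ub = (1 / 2) * margA W ya ua * W2 r ub ya ua

/-- The joint channel in successive form whose b-channel marginal is `q`. -/
def successiveOfMargB {Ya Yr : Type*} [DecidableEq Ya] (q : Ya × Bool × Yr → Bool → ℝ) :
    Ya → Ya × Bool × Yr → Bool → Bool → ℝ :=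
  fun ya yb ua ub => if yb.1 = ya ∧ yb.2.1 = ua then 2 * q (ya, ua, yb.2.2) ub else 0

section SuccessiveForm

variable {Ya Yr : Type*} [Fintype Ya] [Fintype Yr] [DecidableEq Ya]

theorem margB_successiveOfMargB (q : Ya × Bool × Yr → Bool → ℝ) :
    margB (successiveOfMargB q) = q := by
  funext ⟨ya, ua, yr⟩ ub
  cases ua <;> simp [margB, successiveOfMargB]

theorem successiveForm_successiveOfMargB (q : Ya × Bool × Yr → Bool → ℝ) :
    SuccessiveForm (successiveOfMargB q) := by
  intro ya ya' ua' yr ua ub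
  rw [margB_successiveOfMargB]
  rfl

theorem SuccessiveForm.sum_output {W : Ya → Ya × Bool × Yr → Bool → Bool → ℝ}
    (hW : SuccessiveForm W) (ya : Ya) (ua ub : Bool) :
    ∑ yb, W ya yb ua ub = 2 * ∑ yr, margB W (ya, ua, yr) ub := by
  rw [Finset.mul_sum, Fintype.sum_prod_type, Finset.sum_eq_single ya]
  · rw [Fintype.sum_prod_type, Finset.sum_eq_single ua]
    · exact Finset.sum_congr rfl fun yr _ => by rw [hW, if_pos ⟨rfl, rfl⟩]
    · exact fun ua' _ h => Finset.sum_eq_zero fun yr _ => by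
        rw [hW, if_neg fun h' => h h'.2]
    · simp
  · exact fun ya' _ h => Finset.sum_eq_zero fun yr _ => by
      obtain ⟨ua', yr⟩ := yr
      rw [hW, if_neg fun h' => h h'.1]
  · simp

end SuccessiveForm

theorem IsJointChannel.margB_nonneg {Ya Yb : Type*} [Fintype Ya] [Fintype Yb]
    {W : Ya → Yb → Bool → Bool → ℝ} (hW : IsJointChannel W) (yb : Yb) (ub : Bool) :
    0 ≤ margB W yb ub :=
  mul_nonneg (by norm_num)
    (Finset.sum_nonneg fun _ _ => Finset.sum_nonneg fun _ _ => hW.1 _ _ _ _)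

/-- Two outputs which, whenever they have positive probability, share the same `D`-value
have proportional likelihoods. -/
theorem mul_add_eq_mul_add_of_dval_eq {Y : Type*} {V : Y → Bool → ℝ} (hV : ∀ y u, 0 ≤ V y u)
    {y y' : Y} {d : ℝ} (hy : 0 < V y false + V y true → d = dval V y)
    (hy' : 0 < V y' false + V y' true → d = dval V y') (u : Bool) :
    V y u * (V y' false + V y' true) = V y' u * (V y false + V y true) := by
  have h (z : Y) (hz : 0 < V z false + V z true → d = dval V z) :
      V z false - V z true = d * (V z false + V z true) := by
    rcases (add_nonneg (hV z false) (hV z true)).lt_or_eq with hp | h0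
    · rw [hz hp, dval, div_mul_cancel₀ _ hp.ne']
    · have h1 := hV z false
      have h2 := hV z true
      rw [← h0, mul_zero]
      linarith
  have h1 := h y hy
  have h2 := h y' hy'
  cases u
  · linear_combination (1 / 2) * (V y' false + V y' true) * h1
      - (1 / 2) * (V y false + V y true) * h2
  · linear_combination (1 / 2) * (V y false + V y true) * h2
      - (1 / 2) * (V y' false + V y' true) * h1

/-- If the likelihoods `w x r ·` of the outputs sharing a symbol `r` are proportional, then an
upgrade `Q` of the channel `∑ x, w x r ·` lifts to an upgrade of `w` that keeps `x`. -/
theorem exists_upgrade_of_proportional {X R Z : Type*} [Fintype X] [Fintype R] [Fintype Z]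
    (w : X → R → Bool → ℝ) (hw : ∀ x r u, 0 ≤ w x r u)
    (hprop : ∀ x x' r u,
      w x r u * (w x' r false + w x' r true) = w x' r u * (w x r false + w x r true))
    (Q : Z → Bool → ℝ) (hQ : ∀ z u, 0 ≤ Q z u)
    (P : Z → R → ℝ) (hP0 : ∀ z r, 0 ≤ P z r) (hP1 : ∀ z, ∑ r, P z r = 1)
    (hdeg : ∀ r u, ∑ x, w x r u = ∑ z, P z r * Q z u) :
    ∃ (q : X → Z → Bool → ℝ) (B : X → Z → R → ℝ),
      (∀ x z u, 0 ≤ q x z u) ∧ (∀ x z r, 0 ≤ B x z r) ∧ (∀ x z, ∑ r, B x z r = 1) ∧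
      (∀ z u, ∑ x, q x z u = Q z u) ∧
      ∀ x r u, w x r u = ∑ z, B x z r * q x z u := by
  classical
  set s : X → R → ℝ := fun x r => w x r false + w x r true with hs
  set S : R → ℝ := fun r => ∑ x, s x r with hS
  have hs0 (x r) : 0 ≤ s x r := add_nonneg (hw _ _ _) (hw _ _ _)
  have hS0 (r) : 0 ≤ S r := Finset.sum_nonneg fun x _ => hs0 x r
  have hw_zero {r} (h : S r = 0) (x u) : w x r u = 0 := by
    have h1 : s x r = 0 :=
      (Finset.sum_eq_zero_iff_of_nonneg fun x _ => hs0 x r).1 h x (Finset.mem_univ x)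
    have h2 := hw x r false
    have h3 := hw x r true
    simp only [hs] at h1
    cases u <;> linarith
  have hPQ_zero {r} (h : S r = 0) (z u) : P z r * Q z u = 0 := by
    have h1 : ∑ z, P z r * Q z u = 0 := by
      rw [← hdeg]
      exact Finset.sum_eq_zero fun x _ => hw_zero h x u
    exact (Finset.sum_eq_zero_iff_of_nonneg fun z _ => mul_nonneg (hP0 z r) (hQ z u)).1 h1 z
      (Finset.mem_univ z)
  have hw_eq (x r u) : w x r u = s x r / S r * ∑ z, P z r * Q z u := by
    by_cases h : S r = 0
    · rw [hw_zero h, h, div_zero, zero_mul]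
    · have h1 : w x r u * S r = s x r * ∑ x', w x' r u := by
        rw [hS, Finset.mul_sum, Finset.mul_sum]
        exact Finset.sum_congr rfl fun x' _ => by rw [hprop, mul_comm]
      rw [← hdeg, div_mul_eq_mul_div, eq_div_iff h, h1]
  set t : X → Z → R → ℝ := fun x z r => s x r / S r * P z r with ht
  have ht0 (x z r) : 0 ≤ t x z r := mul_nonneg (div_nonneg (hs0 x r) (hS0 r)) (hP0 z r)
  set T : X → Z → ℝ := fun x z => ∑ r, t x z r with hT
  have hT0 (x z) : 0 ≤ T x z := Finset.sum_nonneg fun r _ => ht0 x z r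
  refine ⟨fun x z u => T x z * Q z u,
    fun x z r => if T x z = 0 then P z r else t x z r / T x z,
    fun x z u => mul_nonneg (hT0 x z) (hQ z u), fun x z r => ?_, fun x z => ?_,
    fun z u => ?_, fun x r u => ?_⟩
  · dsimp only
    split_ifs
    exacts [hP0 z r, div_nonneg (ht0 x z r) (hT0 x z)]
  · dsimp only
    split_ifs with h
    · exact hP1 z
    · rw [← Finset.sum_div, div_self h]
  · simp only [hT, ht, Finset.sum_mul]
    rw [Finset.sum_comm]
    trans ∑ r, P z r * Q z u
    · refine Finset.sum_congr rfl fun r _ => ?_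
      simp only [mul_assoc]
      rw [← Finset.sum_mul, ← Finset.sum_div]
      by_cases h : S r = 0
      · rw [hPQ_zero h, mul_zero]
      · rw [div_self h, one_mul]
    · rw [← Finset.sum_mul, hP1, one_mul]
  · rw [hw_eq, Finset.mul_sum]
    refine Finset.sum_congr rfl fun z _ => ?_
    rw [← mul_assoc, ← mul_assoc]
    congr 1
    dsimp only
    split_ifs with h
    · rw [h, mul_zero]
      exact (Finset.sum_eq_zero_iff_of_nonneg fun r _ => ht0 x z r).1 h r (Finset.mem_univ r)
    · rw [div_mul_cancel₀ _ h]

/-- (Upgrading the b-channel.) Let `W` be a joint channel in successive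
form and D-value representation, with `W_b*(d_b|u_b) = Σ_{y_a,u_a} W_b(y_a,u_a,d_b|u_b)`.
If `Q_b*` is upgraded from `W_b*` with degrading channel `P_b*`, then there is a
successive-form joint channel `Q` with `Q ≽p W`, whose b-channel marginal sums to `Q_b*`
and whose a-channel marginal coincides with that of `W`. -/
theorem stmt18 {Ya R Zb : Type*} [Fintype Ya] [Fintype R] [Fintype Zb]
    [DecidableEq Ya]
    (W : Ya → Ya × Bool × R → Bool → Bool → ℝ) (v : R → ℝ)
    (hW : IsJointChannel W) (hsucc : SuccessiveForm W)
    (hrep : DvalRepJoint W v)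
    (Qbstar : Zb → Bool → ℝ) (hQch : IsChannel Qbstar)
    (Pbstar : Zb → R → ℝ)
    (hP0 : ∀ zb r, 0 ≤ Pbstar zb r) (hP1 : ∀ zb, ∑ r, Pbstar zb r = 1)
    (hdeg : ∀ r ub,
      (∑ ya, ∑ ua, margB W (ya, ua, r) ub) = ∑ zb, Pbstar zb r * Qbstar zb ub) :
    ∃ Q : Ya → Ya × Bool × Zb → Bool → Bool → ℝ,
      IsJointChannel Q ∧ SuccessiveForm Q ∧ ProperUpgrade Q W ∧
      (∀ zb ub, (∑ ya, ∑ ua, margB Q (ya, ua, zb) ub) = Qbstar zb ub) ∧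
      (∀ ya ua, margA Q ya ua = margA W ya ua) := by
  have hw0 := hW.margB_nonneg
  obtain ⟨q, B, hq0, hB0, hB1, hqQ, hqw⟩ := exists_upgrade_of_proportional
    (fun (x : Ya × Bool) r u => margB W (x.1, x.2, r) u) (fun x r u => hw0 _ _)
    (fun x x' r u => mul_add_eq_mul_add_of_dval_eq hw0 (hrep x.1 x.2 r) (hrep x'.1 x'.2 r) u)
    Qbstar hQch.1 Pbstar hP0 hP1
    (fun r u => by rw [← hdeg, Fintype.sum_prod_type])
  have hsum (ya : Ya) (ua ub : Bool) :
      ∑ z, q (ya, ua) z ub = ∑ r, margB W (ya, ua, r) ub := by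
    have h (r : R) := hqw (ya, ua) r ub
    simp only at h
    simp only [h]
    rw [Finset.sum_comm]
    simp only [← Finset.sum_mul, hB1, one_mul]
  set Qb : Ya × Bool × Zb → Bool → ℝ := fun y u => q (y.1, y.2.1) y.2.2 u with hQb
  have hQs := successiveForm_successiveOfMargB Qb
  have hout (ya : Ya) (ua ub : Bool) :
      ∑ yb, successiveOfMargB Qb ya yb ua ub = ∑ yb, W ya yb ua ub := by
    rw [hQs.sum_output, hsucc.sum_output, margB_successiveOfMargB, ← hsum]
  refine ⟨successiveOfMargB Qb, ⟨fun ya yb ua ub => ?_, fun ua ub => ?_⟩, hQs, ?_,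
    fun zb ub => ?_, fun ya ua => ?_⟩
  · unfold successiveOfMargB
    split_ifs
    exacts [mul_nonneg zero_le_two (hq0 _ _ _), le_rfl]
  · simp only [hout, hW.2]
  · refine ⟨fun za ya => if za = ya then 1 else 0, fun za ua zr _ yr => B (za, ua) zr yr,
      fun za ya => by dsimp only; split_ifs <;> norm_num, fun za => by simp,
      fun za ua zr _ yr => hB0 _ _ _, fun za ua zr _ => hB1 _ _, fun ya ua yr ub => ?_⟩
    rw [margB_successiveOfMargB, Finset.sum_eq_single ya]
    · simpa using hqw (ya, ua) yr ub
    · exact fun za _ h => by simp [h]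
    · simp
  · rw [margB_successiveOfMargB, ← hqQ, Fintype.sum_prod_type]
  · simp only [margA, hout]
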